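/- arXiv:0911.1737 — 2 statements merged into one kernel-verified Lean document; each statement's English description precedes it below -/
import Mathlib

section
/- Let R be a commutative ring, x, y ∈ R, n a positive integer and k a nonnegative integer. Then the n×n determinant det_{0≤i,j≤n−1}(P⁺_{i+j}(0,k)) equals (−1)^{n₁·C(k+1,2)}·(xy)^{(k+1)²·C(n₁,2)} if n = n₁(k+1) for a positive integer n₁, and equals 0 if k+1 does not divide n. -/
/-- `pgf x y n k` is the generating function `P_n(0,k)` of lattice paths from `(0,0)` to
`(n,k)` with steps `(1,1)`, `(1,0)`, `(1,-1)`, weighted `1`, `x+y`, `xy` respectively: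
`P_n(0,k) = Σ_ℓ C(n,ℓ)·C(n,n−k−ℓ)·x^ℓ·y^{n−k−ℓ}`, the sum over integers `ℓ ≥ 0` with
`n−k−ℓ ≥ 0` (terms with `ℓ > n` vanish since then `C(n,ℓ) = 0`). -/
def pgf {R : Type*} [CommRing R] (x y : R) (n : ℕ) (k : ℤ) : R :=
  ∑ ℓ ∈ Finset.range (n + 1),
    if (ℓ : ℤ) ≤ (n : ℤ) - k then
      (n.choose ℓ : R) * (n.choose ((n : ℤ) - k - ℓ).toNat : R) *
        x ^ ℓ * y ^ ((n : ℤ) - k - ℓ).toNat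
    else 0

/-- `P⁺_n(0,k) = P_n(0,k) − (xy)^{0+1}·P_n(−0−2,k) = P_n(0,k) − xy·P_n(0,k+2)`,
the corresponding generating function for paths never running below the `x`-axis. -/
def pgfPlus {R : Type*} [CommRing R] (x y : R) (n : ℕ) (k : ℤ) : R :=
  pgf x y n k - x * y * pgf x y n (k + 2)

open Polynomial

section LatticePaths

variable {R : Type*} [CommRing R] (x y : R)

/-- The weight polynomial `(1 + xX)(1 + yX)` of one lattice-path step. -/
noncomputable def stepPoly : R[X] := (1 + C x * X) * (1 + C y * X)

lemma coeff_one_add_C_mul_X_pow (a : R) (n m : ℕ) :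
    ((1 + C a * X) ^ n : R[X]).coeff m = n.choose m * a ^ m := by
  have h : ((1 + C a * X) ^ n : R[X]) = ((1 + X) ^ n : R[X]).comp (C a * X) := by simp
  rw [h, comp_C_mul_X_coeff, coeff_one_add_X_pow]

lemma pgf_eq_coeff (n m : ℕ) : pgf x y n ((n : ℤ) - m) = (stepPoly x y ^ n).coeff m := by
  have hsum : (∑ ℓ ∈ Finset.range (n + 1), if ℓ ≤ m then
        (n.choose ℓ : R) * (n.choose (m - ℓ) : R) * x ^ ℓ * y ^ (m - ℓ) else 0) =
      ∑ ℓ ∈ Finset.range (m + 1), (n.choose ℓ : R) * (n.choose (m - ℓ) : R) *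
        x ^ ℓ * y ^ (m - ℓ) := by
    trans ∑ ℓ ∈ Finset.range (n + m + 1), if ℓ ≤ m then
        (n.choose ℓ : R) * (n.choose (m - ℓ) : R) * x ^ ℓ * y ^ (m - ℓ) else 0
    · refine Finset.sum_subset (Finset.range_subset_range.2 (by omega)) fun ℓ _ hℓ => ?_
      rw [Nat.choose_eq_zero_of_lt (by simpa using hℓ)]
      simp
    · symm
      rw [← Finset.sum_filter]
      refine Finset.sum_congr ?_ fun _ _ => rfl
      ext ℓ
      simp only [Finset.mem_range, Finset.mem_filter]
      omega
  rw [stepPoly, mul_pow, coeff_mul, Finset.Nat.sum_antidiagonal_eq_sum_range_succ_mk]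
  trans ∑ ℓ ∈ Finset.range (n + 1), if ℓ ≤ m then
        (n.choose ℓ : R) * (n.choose (m - ℓ) : R) * x ^ ℓ * y ^ (m - ℓ) else 0
  · refine Finset.sum_congr rfl fun ℓ _ => ?_
    have h : ((n : ℤ) - (n - m) - ℓ).toNat = m - ℓ := by omega
    rw [h]
    congr 1
    exact propext (by omega)
  · rw [hsum]
    refine Finset.sum_congr rfl fun ℓ _ => ?_
    simp only [coeff_one_add_C_mul_X_pow]
    ring

lemma pgf_eq_zero_of_lt {n : ℕ} {k : ℤ} (h : n < k) : pgf x y n k = 0 :=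
  Finset.sum_eq_zero fun ℓ _ => if_neg (by omega)

lemma pgf_self (n : ℕ) : pgf x y n n = 1 := by
  have h := pgf_eq_coeff x y n 0
  simp only [Nat.cast_zero, sub_zero] at h
  simp [h, stepPoly, coeff_zero_eq_eval_zero]

lemma pgf_zero_eq_zero {k : ℤ} (h : k ≠ 0) : pgf x y 0 k = 0 := by
  rcases lt_or_gt_of_ne h with h | h
  · obtain ⟨m, rfl⟩ : ∃ m : ℕ, k = ((0 : ℕ) : ℤ) - m := ⟨(-k).toNat, by omega⟩
    rw [pgf_eq_coeff, pow_zero, coeff_one, if_neg (by omega)]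
  · exact pgf_eq_zero_of_lt x y (by exact_mod_cast h)

/-- Decomposition of paths according to their last step. -/
lemma pgf_succ (n : ℕ) (k : ℤ) :
    pgf x y (n + 1) k =
      pgf x y n (k - 1) + (x + y) * pgf x y n k + x * y * pgf x y n (k + 1) := by
  have hstep : stepPoly x y = 1 + C (x + y) * X + C (x * y) * X ^ 2 := by
    simp only [stepPoly, C_add, C_mul]; ring
  have hpow : stepPoly x y ^ (n + 1) = stepPoly x y ^ n +
      C (x + y) * (stepPoly x y ^ n * X) + C (x * y) * (stepPoly x y ^ n * X ^ 2) := by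
    rw [pow_succ, congrArg (stepPoly x y ^ n * ·) hstep]; ring
  rcases lt_or_ge ((n : ℤ) + 1) k with hk | hk
  · rw [pgf_eq_zero_of_lt x y (by push_cast; omega), pgf_eq_zero_of_lt x y (by omega),
      pgf_eq_zero_of_lt x y (by omega), pgf_eq_zero_of_lt x y (by omega)]
    ring
  obtain ⟨m, rfl⟩ : ∃ m : ℕ, k = ((n + 1 : ℕ) : ℤ) - m :=
    ⟨((n : ℤ) + 1 - k).toNat, by push_cast; omega⟩
  have h1 : ((n + 1 : ℕ) : ℤ) - m - 1 = n - m := by push_cast; ring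
  rw [h1, pgf_eq_coeff, pgf_eq_coeff, hpow, coeff_add, coeff_add, coeff_C_mul, coeff_C_mul]
  congr 1
  · congr 2
    cases m with
    | zero => rw [pgf_eq_zero_of_lt x y (by push_cast; omega)]; simp
    | succ m =>
      rw [coeff_mul_X, ← pgf_eq_coeff]
      congr 1
      push_cast; ring
  · congr 1
    rcases lt_or_ge m 2 with hm | hm
    · rw [pgf_eq_zero_of_lt x y (by push_cast; omega), coeff_mul_X_pow', if_neg (by omega)]
    · obtain ⟨m, rfl⟩ := Nat.exists_eq_add_of_le' hm
      rw [coeff_mul_X_pow, ← pgf_eq_coeff]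
      congr 1
      push_cast; ring

lemma pgf_neg (n j : ℕ) : pgf x y n (-j) = (x * y) ^ j * pgf x y n j := by
  induction n generalizing j with
  | zero =>
    rcases eq_or_ne j 0 with rfl | hj
    · simp
    · rw [pgf_zero_eq_zero x y (by simpa using hj), pgf_zero_eq_zero x y (by simpa using hj),
        mul_zero]
  | succ n ih =>
    cases j with
    | zero => simp
    | succ j =>
      have h1 : -((j + 1 : ℕ) : ℤ) - 1 = -((j + 2 : ℕ) : ℤ) := by push_cast; ring
      have h2 : -((j + 1 : ℕ) : ℤ) + 1 = -(j : ℤ) := by push_cast; ring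
      have h3 : ((j + 1 : ℕ) : ℤ) - 1 = j := by push_cast; ring
      have h4 : ((j + 1 : ℕ) : ℤ) + 1 = (j + 2 : ℕ) := by push_cast; ring
      rw [pgf_succ, pgf_succ, h1, h2, h3, h4, ih, ih, ih]
      ring

lemma pgfPlus_succ (n : ℕ) (k : ℤ) :
    pgfPlus x y (n + 1) k =
      pgfPlus x y n (k - 1) + (x + y) * pgfPlus x y n k + x * y * pgfPlus x y n (k + 1) := by
  have h1 : k - 1 + 2 = k + 2 - 1 := by ring
  have h2 : k + 1 + 2 = k + 2 + 1 := by ring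
  rw [pgfPlus, pgfPlus, pgfPlus, pgfPlus, pgf_succ, pgf_succ, h1, h2]
  ring

lemma pgfPlus_neg_one (n : ℕ) : pgfPlus x y n (-1) = 0 := by
  have h := pgf_neg x y n 1
  norm_num at h
  norm_num [pgfPlus, h]

lemma pgfPlus_eq_zero_of_lt {n : ℕ} {k : ℤ} (h : n < k) : pgfPlus x y n k = 0 := by
  rw [pgfPlus, pgf_eq_zero_of_lt x y h, pgf_eq_zero_of_lt x y (by omega), mul_zero, sub_zero]

lemma pgfPlus_self (n : ℕ) : pgfPlus x y n n = 1 := by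
  rw [pgfPlus, pgf_self, pgf_eq_zero_of_lt x y (by omega), mul_zero, sub_zero]

end LatticePaths

section Hankel

variable {R : Type*} [CommRing R]

/-- The shift operator `(h n) ↦ (h (n + 1))` on sequences. -/
def seqShift (R : Type*) [CommRing R] : Module.End R (ℕ → R) :=
  LinearMap.funLeft R R Nat.succ

lemma seqShift_apply (h : ℕ → R) (n : ℕ) : seqShift R h n = h (n + 1) := rfl

lemma seqShift_pow_apply (h : ℕ → R) (l n : ℕ) : (seqShift R ^ l) h n = h (l + n) := by
  induction l generalizing n with
  | zero => simp
  | succ l ih =>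
    rw [pow_succ', Module.End.mul_apply, seqShift_apply, ih]
    congr 1
    ring

/-- In a Hankel determinant the monomials indexing the rows may be replaced by any sequence of
monic polynomials of the same degrees. -/
lemma det_hankel_eq_det_aeval (h : ℕ → R) (p : ℕ → R[X]) (hp : ∀ i, (p i).Monic)
    (hdeg : ∀ i, (p i).natDegree = i) (n : ℕ) :
    Matrix.det (Matrix.of fun i j : Fin n => h (i.1 + j.1)) =
      Matrix.det (Matrix.of fun i j : Fin n => aeval (seqShift R) (p i) h j.1) := by
  let L : Matrix (Fin n) (Fin n) R := Matrix.of fun i l => (p i).coeff l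
  have hL : L.det = 1 := by
    rw [Matrix.det_of_isLowerTriangular L]
    · refine Finset.prod_eq_one fun i _ => ?_
      have h := (hp i).coeff_natDegree
      rwa [hdeg] at h
    · intro i j hij
      exact coeff_eq_zero_of_natDegree_lt (by rw [hdeg]; exact hij)
  rw [← one_mul (Matrix.det _), ← hL, ← Matrix.det_mul]
  congr 1
  ext i j
  rw [Matrix.mul_apply, Matrix.of_apply,
    aeval_eq_sum_range' (show (p i).natDegree < n by rw [hdeg]; exact i.2),
    LinearMap.sum_apply, Finset.sum_apply, Finset.sum_range]
  simp [L, seqShift_pow_apply]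

end Hankel

section Dickson

variable {R : Type*} [CommRing R]

lemma dickson_succ_monic_and_natDegree [Nontrivial R] (k : ℕ) (a : R) (n : ℕ) :
    (dickson k a (n + 1)).Monic ∧ (dickson k a (n + 1)).natDegree = n + 1 := by
  induction n using Nat.twoStepInduction with
  | zero => simp
  | one =>
    have h : dickson k a (1 + 1) = X ^ 2 - C (a * (3 - k)) := by
      rw [one_add_one_eq_two, dickson_two, C_mul, C_sub, map_ofNat, map_natCast]
    rw [h]
    exact ⟨monic_X_pow_sub_C _ two_ne_zero, natDegree_X_pow_sub_C⟩
  | more n ih1 ih2 =>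
    have hX : (X * dickson k a (n + 2)).Monic := monic_X.mul ih2.1
    have hXd : (X * dickson k a (n + 2)).natDegree = n + 3 := by
      rw [monic_X.natDegree_mul ih2.1, ih2.2, natDegree_X]; ring
    have hlt : (C a * dickson k a (n + 1)).natDegree < (X * dickson k a (n + 2)).natDegree := by
      rw [hXd]
      refine (natDegree_C_mul_le _ _).trans_lt ?_
      rw [ih1.2]
      omega
    rw [show n + 1 + 1 + 1 = (n + 1) + 2 from rfl, dickson_add_two]
    exact ⟨hX.sub_of_left (degree_lt_degree hlt),
      (natDegree_sub_eq_left_of_natDegree_lt hlt).trans hXd⟩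

variable {M : Type*} [AddCommGroup M] [Module R M] {F : ℤ → M}

/-- If `T` acts on a bi-infinite sequence as a weighted step `±1`, then the Dickson polynomial of
the first kind of degree `q` acts as a weighted step `±q`. -/
lemma aeval_dickson_one_apply {c : R} {T : Module.End R M}
    (hT : ∀ m, T (F m) = F (m - 1) + c • F (m + 1)) (q : ℕ) (m : ℤ) :
    aeval T (dickson 1 c q) (F m) = F (m - q) + c ^ q • F (m + q) := by
  induction q using Nat.twoStepInduction generalizing m with
  | zero =>
    have h : dickson 1 c 0 = 2 := by rw [dickson_zero]; norm_num
    rw [h, map_ofNat, Module.End.ofNat_apply]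
    simp [two_smul]
  | one => simpa using hT m
  | more q ih1 ih2 =>
    rw [dickson_add_two, map_sub, map_mul, map_mul, aeval_X, aeval_C, LinearMap.sub_apply,
      Module.End.mul_apply, Module.End.mul_apply, ih1, ih2, map_add, map_smul, hT, hT,
      Module.algebraMap_end_apply]
    have h1 : m - ((q + 1 : ℕ) : ℤ) - 1 = m - ((q + 2 : ℕ) : ℤ) := by push_cast; ring
    have h2 : m - ((q + 1 : ℕ) : ℤ) + 1 = m - q := by push_cast; ring
    have h3 : m + ((q + 1 : ℕ) : ℤ) - 1 = m + q := by push_cast; ring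
    have h4 : m + ((q + 1 : ℕ) : ℤ) + 1 = m + ((q + 2 : ℕ) : ℤ) := by push_cast; ring
    rw [h1, h2, h3, h4]
    module

/-- If `W` acts on a bi-infinite sequence as a weighted step `±q` and the sequence vanishes one
step below `m`, then the Dickson polynomial of the second kind of degree `a` moves the term at `m`
up by `a` steps. -/
lemma aeval_dickson_two_apply {d : R} {W : Module.End R M} {q m : ℤ}
    (hW : ∀ m, W (F m) = F (m - q) + d • F (m + q)) (hF : F (m - q) = 0) (a : ℕ) :
    aeval W (dickson 2 d a) (F m) = d ^ a • F (m + a * q) := by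
  induction a using Nat.twoStepInduction with
  | zero =>
    have h : dickson 2 d 0 = 1 := by rw [dickson_zero]; norm_num
    simp [h]
  | one => simp [hW, hF]
  | more a ih1 ih2 =>
    rw [dickson_add_two, map_sub, map_mul, map_mul, aeval_X, aeval_C, LinearMap.sub_apply,
      Module.End.mul_apply, Module.End.mul_apply, ih1, ih2, map_smul, hW,
      Module.algebraMap_end_apply]
    have h1 : m + ((a + 1 : ℕ) : ℤ) * q - q = m + a * q := by push_cast; ring
    have h2 : m + ((a + 1 : ℕ) : ℤ) * q + q = m + ((a + 2 : ℕ) : ℤ) * q := by push_cast; ring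
    rw [h1, h2]
    module

end Dickson

section BlockReversal

lemma Fin.sign_revPerm (n : ℕ) : Equiv.Perm.sign (Fin.revPerm (n := n)) = (-1) ^ n.choose 2 := by
  rw [Equiv.Perm.sign_eq_prod_prod_Iio]
  have h : ∀ j : Fin n, ∏ i ∈ Finset.Iio j,
      (if Fin.revPerm i < Fin.revPerm j then (1 : ℤˣ) else -1) = (-1) ^ (j : ℕ) := by
    intro j
    rw [Finset.prod_congr rfl (g := fun _ => (-1 : ℤˣ)), Finset.prod_const, Fin.card_Iio]
    intro i hi
    rw [if_neg]
    simpa using (Finset.mem_Iio.1 hi).le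
  rw [Finset.prod_congr rfl fun j _ => h j, Finset.prod_pow_eq_pow_sum,
    Fin.sum_univ_eq_sum_range (fun i => i), Finset.sum_range_id, Nat.choose_two_right]

/-- The permutation of `Fin (m * q)` reversing each block of `q` consecutive elements. -/
def blockRev (m q : ℕ) : Equiv.Perm (Fin (m * q)) :=
  finProdFinEquiv.permCongr (Equiv.prodCongrRight fun _ : Fin m => Fin.revPerm (n := q))

lemma sign_blockRev (m q : ℕ) :
    Equiv.Perm.sign (blockRev m q) = (-1) ^ (m * q.choose 2) := by
  rw [blockRev, Equiv.Perm.sign_permCongr, Equiv.Perm.sign_prodCongrRight]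
  simp only [Fin.sign_revPerm, Finset.prod_const, Finset.card_univ, Fintype.card_fin]
  rw [← pow_mul, mul_comm]

lemma blockRev_apply {m q : ℕ} (i : Fin (m * q)) :
    (blockRev m q i : ℕ) = q * (i / q) + (q - 1 - i % q) := by
  simp [blockRev, Equiv.permCongr_apply, finProdFinEquiv, Fin.val_rev]
  omega

end BlockReversal

section HankelPaths

variable {R : Type*} [CommRing R] (x y : R)

/-- The monic polynomial of degree `i` which indexes the `i`-th row of the reduced matrix. -/
noncomputable def rowPoly (q i : ℕ) : R[X] :=
  (dickson 2 ((x * y) ^ q) (i / q)).comp ((dickson 1 (x * y) q).comp (X - C (x + y))) * X ^ (i % q)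

lemma rowPoly_monic_and_natDegree [Nontrivial R] (k i : ℕ) :
    (rowPoly x y (k + 1) i).Monic ∧ (rowPoly x y (k + 1) i).natDegree = i := by
  have hmul : ∀ p q : R[X], p.Monic → q.Monic → (p.comp q).natDegree = p.natDegree * q.natDegree :=
    fun p q hp hq => natDegree_comp_eq_of_mul_ne_zero (by simp [hp.leadingCoeff, hq.leadingCoeff])
  have hD := dickson_succ_monic_and_natDegree 1 (x * y) k
  have hX := monic_X_sub_C (x + y)
  set W := (dickson 1 (x * y) (k + 1)).comp (X - C (x + y)) with hWdef
  have hWd : W.natDegree = k + 1 := by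
    rw [hWdef, hmul _ _ hD.1 hX, natDegree_X_sub_C, hD.2, mul_one]
  have hW : W.Monic := hD.1.comp hX (by rw [natDegree_X_sub_C]; exact one_ne_zero)
  have hV : ((dickson 2 ((x * y) ^ (k + 1)) (i / (k + 1))).comp W).Monic ∧
      ((dickson 2 ((x * y) ^ (k + 1)) (i / (k + 1))).comp W).natDegree = i / (k + 1) * (k + 1) := by
    cases i / (k + 1) with
    | zero =>
      have h : dickson 2 ((x * y) ^ (k + 1)) 0 = 1 := by rw [dickson_zero]; norm_num
      simp [h]
    | succ a =>
      have hE := dickson_succ_monic_and_natDegree 2 ((x * y) ^ (k + 1)) a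
      exact ⟨hE.1.comp hW (by omega), by rw [hmul _ _ hE.1 hW, hE.2, hWd]⟩
  refine ⟨hV.1.mul (monic_X_pow _), ?_⟩
  rw [rowPoly, hV.1.natDegree_mul (monic_X_pow _), hV.2, natDegree_X_pow, Nat.div_add_mod']

lemma aeval_rowPoly (k i j : ℕ) :
    aeval (seqShift R) (rowPoly x y (k + 1) i) (fun n => pgfPlus x y n k) j =
      (x * y) ^ ((k + 1) * (i / (k + 1))) *
        pgfPlus x y (i % (k + 1) + j) (((k + 1) * (i / (k + 1)) + k : ℕ) : ℤ) := by
  let F : ℤ → ℕ → R := fun m n => pgfPlus x y n m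
  have hT : ∀ m, aeval (seqShift R) (X - C (x + y)) (F m) =
      F (m - 1) + (x * y) • F (m + 1) := by
    intro m
    ext n
    simp [F, seqShift_apply, pgfPlus_succ, Module.algebraMap_end_apply]
    ring
  have hW := aeval_dickson_one_apply hT (k + 1)
  have hF : F ((k : ℤ) - ((k + 1 : ℕ) : ℤ)) = 0 := by
    ext n
    have h : (k : ℤ) - ((k + 1 : ℕ) : ℤ) = -1 := by push_cast; ring
    rw [h]
    exact pgfPlus_neg_one x y n
  have hV := aeval_dickson_two_apply hW hF (i / (k + 1))
  rw [rowPoly, mul_comm, map_mul, aeval_comp, aeval_comp, Module.End.mul_apply, map_pow, aeval_X,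
    seqShift_pow_apply]
  refine (congrFun hV _).trans ?_
  rw [Pi.smul_apply, smul_eq_mul, ← pow_mul]
  congr 2
  push_cast
  ring

/-- The Hankel determinant after replacing the row monomials by `rowPoly`. -/
lemma det_pgfPlus_eq_det_reduced (n k : ℕ) :
    Matrix.det (Matrix.of fun i j : Fin n => pgfPlus x y (i.1 + j.1) (k : ℤ)) =
      Matrix.det (Matrix.of fun i j : Fin n => (x * y) ^ ((k + 1) * (i.1 / (k + 1))) *
        pgfPlus x y (i.1 % (k + 1) + j.1) (((k + 1) * (i.1 / (k + 1)) + k : ℕ) : ℤ)) := by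
  nontriviality R
  rw [det_hankel_eq_det_aeval (fun n => pgfPlus x y n k) (rowPoly x y (k + 1))
    (fun i => (rowPoly_monic_and_natDegree x y k i).1)
    (fun i => (rowPoly_monic_and_natDegree x y k i).2)]
  simp only [aeval_rowPoly]

end HankelPaths

/-- Theorem 1: `det_{0≤i,j≤n−1}(P⁺_{i+j}(0,k))` equals
`(−1)^{n₁·C(k+1,2)}·(xy)^{(k+1)²·C(n₁,2)}` if `n = n₁(k+1)` with `n₁ ≥ 1`,
and `0` if `k+1 ∤ n`. -/
theorem det_hankel_pgfPlus {R : Type*} [CommRing R] (x y : R) (n : ℕ) (hn : 0 < n) (k : ℕ) :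
    (∀ n₁ : ℕ, 0 < n₁ → n = n₁ * (k + 1) →
      Matrix.det (Matrix.of fun i j : Fin n => pgfPlus x y (i.1 + j.1) (k : ℤ)) =
        (-1 : R) ^ (n₁ * Nat.choose (k + 1) 2) *
          (x * y) ^ ((k + 1) ^ 2 * Nat.choose n₁ 2)) ∧
    (¬ (k + 1) ∣ n →
      Matrix.det (Matrix.of fun i j : Fin n => pgfPlus x y (i.1 + j.1) (k : ℤ)) = 0) := by
  have hq : 0 < k + 1 := k.succ_pos
  rw [det_pgfPlus_eq_det_reduced]
  refine ⟨?_, fun hdvd => ?_⟩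
  · rintro m - rfl
    set N := Matrix.of fun i j : Fin (m * (k + 1)) => (x * y) ^ ((k + 1) * (i.1 / (k + 1))) *
        pgfPlus x y (i.1 % (k + 1) + j.1) (((k + 1) * (i.1 / (k + 1)) + k : ℕ) : ℤ) with hN
    have hentry : ∀ i j, N.submatrix (blockRev m (k + 1)) id i j =
        (x * y) ^ ((k + 1) * (i.1 / (k + 1))) *
          pgfPlus x y (k - i.1 % (k + 1) + j.1) (((k + 1) * (i.1 / (k + 1)) + k : ℕ) : ℤ) := by
      intro i j
      have hlt : k - i.1 % (k + 1) < k + 1 := by omega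
      rw [Matrix.submatrix_apply, hN, Matrix.of_apply, blockRev_apply, Nat.add_sub_cancel,
        Nat.mul_add_div hq, Nat.div_eq_of_lt hlt, Nat.mul_add_mod, Nat.mod_eq_of_lt hlt]
      rfl
    have hdet : (N.submatrix (blockRev m (k + 1)) id).det =
        (x * y) ^ ((k + 1) ^ 2 * Nat.choose m 2) := by
      rw [Matrix.det_of_isUpperTriangular]
      · trans ∏ i : Fin (m * (k + 1)), (x * y) ^ ((k + 1) * (i.1 / (k + 1)))
        · refine Finset.prod_congr rfl fun i _ => ?_
          have hmod := Nat.mod_lt i.1 hq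
          have hdiv := Nat.div_add_mod i.1 (k + 1)
          have h : k - i.1 % (k + 1) + i.1 = (k + 1) * (i.1 / (k + 1)) + k := by omega
          rw [hentry, h, pgfPlus_self, mul_one]
        · rw [Finset.prod_pow_eq_pow_sum, ← finProdFinEquiv.sum_comp, Fintype.sum_prod_type]
          have h : ∀ (a : Fin m) (r : Fin (k + 1)),
              (finProdFinEquiv (a, r) : ℕ) / (k + 1) = a := by
            intro a r
            rw [finProdFinEquiv_apply_val, Nat.add_mul_div_left _ _ hq,
              Nat.div_eq_of_lt r.2, zero_add]
          simp only [h, Finset.sum_const, Finset.card_univ, Fintype.card_fin, smul_eq_mul]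
          rw [← Finset.mul_sum, ← Finset.mul_sum, Fin.sum_univ_eq_sum_range (fun i => i),
            Finset.sum_range_id, ← Nat.choose_two_right, ← mul_assoc, ← sq]
      · intro i j hij
        have hij' : j.1 < i.1 := hij
        have hmod := Nat.mod_lt i.1 hq
        have hdiv := Nat.div_add_mod i.1 (k + 1)
        rw [hentry, pgfPlus_eq_zero_of_lt x y (by omega), mul_zero]
    rw [Matrix.det_permute, sign_blockRev] at hdet
    rw [← hdet, ← mul_assoc]
    push_cast
    rw [← mul_pow]
    simp
  · have hmod : n % (k + 1) ≠ 0 := fun h => hdvd (Nat.dvd_of_mod_eq_zero h)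
    have hdiv := Nat.div_add_mod n (k + 1)
    have hlt := Nat.mod_lt n hq
    refine Matrix.det_eq_zero_of_row_eq_zero ⟨(k + 1) * (n / (k + 1)), by omega⟩ fun j => ?_
    have hj := j.2
    rw [Matrix.of_apply]
    simp only [Nat.mul_mod_right, Nat.mul_div_cancel_left _ hq]
    rw [pgfPlus_eq_zero_of_lt x y (by omega), mul_zero]
end

section
/- Let R be a commutative ring, x, y ∈ R, n a positive integer and k a nonnegative integer. Then det_{0≤i,j≤n−1}(P⁺_{i+j+1}(0,k)) equals (−1)^{n₁·C(k+1,2)}·(xy)^{(k+1)²·C(n₁,2)}·Σ_{s=0}^{n₁} x^{s(k+1)} y^{(n₁−s)(k+1)} if n = n₁(k+1) for a positive integer n₁; it equals (−1)^{n₁·C(k+1,2)+C(k,2)}·(xy)^{(k+1)²·C(n₁,2)+n₁k(k+1)}·Σ_{s=0}^{n₁} x^{s(k+1)} y^{(n₁−s)(k+1)} if n = n₁(k+1)+k for a nonnegative integer n₁; and it equals 0 if n is congruent to neither 0 nor k modulo k+1. (The sum Σ_{s=0}^{n₁} x^{s(k+1)} y^{(n₁−s)(k+1)} is the polynomial form of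 (y^{(k+1)(n₁+1)}−x^{(k+1)(n₁+1)})/(y^{k+1}−x^{k+1}).) -/
section HankelDet

open Polynomial

variable {R : Type*} [CommRing R]

/-- Replacing the monomials by monic polynomials of the same degrees does not change the
determinant of a matrix of linear functionals. -/
theorem det_linearMap_monic {n : ℕ} (L : Fin n → R[X] →ₗ[R] R) (e : ℕ → R[X])
    (hdeg : ∀ i, (e i).natDegree = i) (hmonic : ∀ i, (e i).Monic) :
    (Matrix.of fun i j : Fin n => L i (e j)).det =
      (Matrix.of fun i j : Fin n => L i (X ^ (j : ℕ))).det := by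
  have h : (Matrix.of fun i j : Fin n => L i (e j)) =
      (Matrix.of fun i j : Fin n => L i (X ^ (j : ℕ))) *
        Matrix.of fun i j : Fin n => (e j).coeff i := by
    ext i j
    have hj : (e j).natDegree < n := by rw [hdeg]; exact j.2
    rw [Matrix.mul_apply, Matrix.of_apply]
    conv_lhs => rw [(e j).as_sum_range' n hj]
    rw [map_sum, ← Fin.sum_univ_eq_sum_range (fun a => L i (monomial a ((e j).coeff a)))]
    refine Finset.sum_congr rfl fun a _ => ?_
    rw [← C_mul_X_pow_eq_monomial, ← smul_eq_C_mul, map_smul, smul_eq_mul, mul_comm]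
    rfl
  rw [h, Matrix.det_mul, Matrix.det_matrixOfPolynomials (fun j : Fin n => e j)
    (fun j => hdeg j) (fun j => hmonic j), mul_one]

/-- A matrix whose last row is a multiple of the first unit vector. -/
theorem det_of_last_row_eq_single {n : ℕ} (F : ℕ → ℕ → R)
    (h : ∀ j, 0 < j → j ≤ n → F n j = 0) :
    (Matrix.of fun i j : Fin (n + 1) => F i j).det =
      (-1) ^ n * F n 0 * (Matrix.of fun i j : Fin n => F i (j + 1)).det := by
  rw [Matrix.det_succ_row _ (Fin.last n), Finset.sum_eq_single 0]
  · have : (Matrix.of fun i j : Fin (n + 1) => F i j).submatrix (Fin.last n).succAbove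
        (Fin.succAbove 0) = Matrix.of fun i j : Fin n => F i (j + 1) := by
      ext i j
      simp
    rw [this]
    simp
  · intro j _ hj
    have hj' : 0 < (j : ℕ) := Nat.pos_of_ne_zero fun h' => hj (Fin.ext h')
    rw [Matrix.of_apply, Fin.val_last, h j hj' (Nat.le_of_lt_succ j.2), mul_zero, zero_mul]
  · simp

/-- The determinant of a block lower triangular matrix with two diagonal blocks. -/
theorem det_of_lower_blocks {N s M : ℕ} (hM : M = N + s) (F : ℕ → ℕ → R)
    (h : ∀ i j, i < N → N ≤ j → j < M → F i j = 0) :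
    (Matrix.of fun i j : Fin M => F i j).det =
      (Matrix.of fun i j : Fin N => F i j).det *
        (Matrix.of fun i j : Fin s => F (N + i) (N + j)).det := by
  subst hM
  rw [← Matrix.det_fromBlocks_zero₁₂ _ (Matrix.of fun (i : Fin s) (j : Fin N) => F (N + i) j),
    ← Matrix.det_submatrix_equiv_self finSumFinEquiv]
  congr 1
  ext (i | i) (j | j)
  · simp
  · simp [h i (N + j) i.2 (by lia) (by lia)]
  · simp
  · simp

/-- The determinant of a block diagonal matrix with diagonal blocks of equal size. -/
theorem det_of_diagonal_blocks (K m : ℕ) (F : ℕ → ℕ → R)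
    (h : ∀ i j, i / K ≠ j / K → F i j = 0) :
    (Matrix.of fun i j : Fin (m * K) => F i j).det =
      ∏ l ∈ Finset.range m, (Matrix.of fun i j : Fin K => F (l * K + i) (l * K + j)).det := by
  induction m with
  | zero =>
    rw [Finset.prod_range_zero]
    have : IsEmpty (Fin (0 * K)) := by rw [zero_mul]; infer_instance
    exact Matrix.det_isEmpty
  | succ m ih =>
    rw [det_of_lower_blocks (N := m * K) (s := K) (by ring), ih, Finset.prod_range_succ]
    intro i j hi hj hM
    apply h
    have h1 : i / K < m := Nat.div_lt_of_lt_mul (by rwa [mul_comm])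
    have hK : 0 < K := Nat.pos_of_ne_zero (by rintro rfl; simp at hi)
    have h2 : m ≤ j / K := (Nat.le_div_iff_mul_le hK).2 hj
    lia

/-- The determinant of a matrix that vanishes above the antidiagonal. -/
theorem det_of_antitriangular (m : ℕ) (F : ℕ → ℕ → R)
    (h : ∀ i j, i + j + 1 < m → F i j = 0) (c : R) (hc : ∀ i j, i + j + 1 = m → F i j = c) :
    (Matrix.of fun i j : Fin m => F i j).det = (-1) ^ m.choose 2 * c ^ m := by
  induction m generalizing F with
  | zero => simp
  | succ m ih =>
    have key := ih (fun i j => F (i + 1) j) (fun i j hij => h _ _ (by lia))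
      (fun i j hij => hc _ _ (by lia))
    rw [Matrix.det_succ_row_zero, Finset.sum_eq_single (Fin.last m)]
    · have : (Matrix.of fun i j : Fin (m + 1) => F i j).submatrix Fin.succ
          (Fin.last m).succAbove = Matrix.of fun i j : Fin m => F (i + 1) j := by
        ext i j
        simp
      rw [this, key, Matrix.of_apply, hc _ _ (by simp), Nat.choose_succ_succ' m 1,
        Nat.choose_one_right, Fin.val_last]
      ring
    · intro j _ hj
      have : (j : ℕ) ≠ m := fun h' => hj (Fin.ext h')
      simp [h 0 j (by lia)]
    · simp

theorem dickson_monic_natDegree [Nontrivial R] (k : ℕ) (a : R) (n : ℕ) :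
    (dickson k a (n + 1)).Monic ∧ (dickson k a (n + 1)).natDegree = n + 1 ∧
      (dickson k a n).natDegree ≤ n := by
  induction n with
  | zero =>
    refine ⟨by simp [monic_X], by simp, ?_⟩
    have : dickson k a 0 = C (3 - (k : R)) := by rw [dickson_zero, C_sub, C_ofNat, C_eq_natCast]
    rw [this, natDegree_C]
  | succ n ih =>
    obtain ⟨hm, hd, hl⟩ := ih
    have hX : (X * dickson k a (n + 1)).Monic := monic_X.mul hm
    have hXd : (X * dickson k a (n + 1)).natDegree = n + 2 := by
      rw [monic_X.natDegree_mul hm, hd, natDegree_X]; ring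
    have hlt : (C a * dickson k a n).natDegree < n + 2 :=
      ((natDegree_C_mul_le _ _).trans hl).trans_lt (by lia)
    have hlt' : (C a * dickson k a n).degree < (X * dickson k a (n + 1)).degree := by
      apply degree_lt_degree; rw [hXd]; exact hlt
    rw [dickson_add_two]
    refine ⟨hX.sub_of_left hlt', ?_, hd.le⟩
    rw [natDegree_sub_eq_left_of_natDegree_lt (by rw [hXd]; exact hlt), hXd]

theorem dickson_two_at_zero (a : R) : dickson 2 a 0 = 1 := by
  rw [dickson_zero]
  push_cast
  ring

theorem dickson_two_mul (a : R) (m l : ℕ) :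
    dickson 2 a (m + 1) * dickson 2 a (l + 1) =
      dickson 2 a (m + l + 2) + C a * (dickson 2 a m * dickson 2 a l) := by
  induction l using Nat.twoStepInduction with
  | zero =>
    simp only [zero_add, dickson_one, dickson_zero, add_zero, dickson_add_two]
    push_cast
    ring
  | one =>
    have h : dickson 2 a (m + 1 + 2) = X * dickson 2 a (m + 1 + 1) - C a * dickson 2 a (m + 1) :=
      dickson_add_two ..
    have h0 : dickson 2 a (0 + 2) = X * X - C a := by
      rw [dickson_add_two, dickson_zero, zero_add, dickson_one]
      push_cast
      ring
    rw [h, h0, dickson_add_two, dickson_one]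
    ring
  | more l h1 h2 =>
    have h : dickson 2 a (m + (l + 2) + 2) =
        X * dickson 2 a (m + (l + 1) + 2) - C a * dickson 2 a (m + l + 2) :=
      dickson_add_two ..
    rw [h, dickson_add_two 2 a (l + 1)]
    linear_combination X * h2 - C a * h1 - C a * dickson 2 a m * dickson_add_two 2 a l

theorem dickson_one_eval₂ {A : Type*} [CommRing A] (f : R →+* A) (a : R) (z w : A)
    (h : f a = z * w) (n : ℕ) : (dickson 1 a n).eval₂ f (z + w) = z ^ n + w ^ n := by
  induction n using Nat.twoStepInduction with
  | zero =>
    have : dickson 1 a 0 = C 2 := by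
      rw [dickson_zero]
      have : (C 2 : R[X]) = 2 := rfl
      rw [this]; push_cast; ring
    rw [this, eval₂_C, map_ofNat]; ring
  | one => simp
  | more n h1 h2 =>
    simp only [dickson_add_two, eval₂_sub, eval₂_mul, eval₂_X, eval₂_C, h1, h2, h]
    ring

theorem dickson_two_eval₂ {A : Type*} [CommRing A] (f : R →+* A) (a : R) (z w : A)
    (h : f a = z * w) (n : ℕ) :
    (dickson 2 a n).eval₂ f (z + w) = ∑ s ∈ Finset.range (n + 1), z ^ s * w ^ (n - s) := by
  have hsum : ∀ n : ℕ, ∑ s ∈ Finset.range (n + 1 + 1), z ^ s * w ^ (n + 1 - s) =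
      w * (∑ s ∈ Finset.range (n + 1), z ^ s * w ^ (n - s)) + z ^ (n + 1) := by
    intro n
    rw [Finset.sum_range_succ, Finset.mul_sum]
    congr 1
    · refine Finset.sum_congr rfl fun s hs => ?_
      rw [Nat.succ_sub (by simpa [Nat.lt_succ_iff] using hs), pow_succ]
      ring
    · simp
  induction n using Nat.twoStepInduction with
  | zero =>
    rw [dickson_two_at_zero]
    simp
  | one => simp [Finset.sum_range_succ, add_comm]
  | more n h1 h2 =>
    simp only [dickson_add_two, eval₂_sub, eval₂_mul, eval₂_X, eval₂_C, h1, h2, h]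
    rw [hsum (n + 1), hsum n]
    ring

end HankelDet

section PathFunctional

open Polynomial LaurentPolynomial

variable {R : Type*} [CommRing R]

/-- The down-step `xy/z` as a Laurent polynomial in `z`. -/
noncomputable def downStep (x y : R) : R[T;T⁻¹] := LaurentPolynomial.C (x * y) * T (-1)

/-- The step generating function `z + (x + y) + xy/z`. -/
noncomputable def stepGF (x y : R) : R[T;T⁻¹] :=
  T 1 + LaurentPolynomial.C (x + y) + downStep x y

/-- The linear functional on polynomials in the step generating function which extracts the
coefficient of `z ^ k` after multiplication by `1 - xy/z²`. -/
noncomputable def pathFunctional (x y : R) (k : ℕ) : R[X] →ₗ[R] R where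
  toFun f := (T (-1) * ((T 1 - downStep x y) *
    f.eval₂ LaurentPolynomial.C (stepGF x y))).coeff (k : ℤ)
  map_add' f g := by simp only [eval₂_add, mul_add, AddMonoidAlgebra.coeff_add, Finsupp.add_apply]
  map_smul' r f := by
    rw [RingHom.id_apply, smul_eq_mul, eval₂_smul, ← LaurentPolynomial.smul_eq_C_mul,
      mul_smul_comm, mul_smul_comm, AddMonoidAlgebra.coeff_smul, Finsupp.smul_apply, smul_eq_mul]

theorem pathFunctional_apply (x y : R) (k : ℕ) (f : R[X]) :
    pathFunctional x y k f = (T (-1) * ((T 1 - downStep x y) *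
      f.eval₂ LaurentPolynomial.C (stepGF x y))).coeff (k : ℤ) := rfl

theorem coeff_C_mul_T (r : R) (m j : ℤ) :
    (LaurentPolynomial.C r * T m).coeff j = if m = j then r else 0 := by
  rw [← single_eq_C_mul_T, AddMonoidAlgebra.coeff_single, Finsupp.single_apply]

theorem C_mul_downStep (x y : R) : LaurentPolynomial.C (x * y) = T 1 * downStep x y := by
  rw [downStep, mul_left_comm, ← T_add]
  simp

theorem coeff_pow_mul_downStep_pow (x y : R) (k a b : ℕ) :
    (T (-1) * (T 1 ^ a * downStep x y ^ b)).coeff (k : ℤ) =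
      if a = b + (k + 1) then (x * y) ^ b else 0 := by
  have : T (-1) * (T 1 ^ a * downStep x y ^ b) =
      LaurentPolynomial.C ((x * y) ^ b) * T ((a : ℤ) - b - 1) := by
    have hT : (T ((a : ℤ) - b - 1) : R[T;T⁻¹]) = T (-1) * (T 1 ^ a * T (-1) ^ b) := by
      rw [T_pow, T_pow, ← T_add, ← T_add]
      congr 1
      ring
    rw [downStep, mul_pow, map_pow, hT]
    ring
  rw [this, coeff_C_mul_T]
  exact if_congr (by lia) rfl rfl

theorem coeff_stepGF_pow (x y : R) (n : ℕ) (j : ℤ) :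
    (stepGF x y ^ n).coeff j = pgf x y n j := by
  have h : stepGF x y = (LaurentPolynomial.C x * T (-1) + 1) * (LaurentPolynomial.C y + T 1) := by
    have hT : (T (-1) * T 1 : R[T;T⁻¹]) = 1 := by rw [← T_add]; simp
    rw [stepGF, downStep, map_add, map_mul]
    linear_combination -LaurentPolynomial.C x * hT
  rw [h, mul_pow, add_pow, add_pow, Finset.sum_mul_sum, AddMonoidAlgebra.coeff_sum,
    Finsupp.finsetSum_apply, pgf]
  refine Finset.sum_congr rfl fun l hl => ?_
  rw [AddMonoidAlgebra.coeff_sum, Finsupp.finsetSum_apply]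
  have hterm : ∀ m ∈ Finset.range (n + 1),
      ((LaurentPolynomial.C x * T (-1)) ^ l * 1 ^ (n - l) * (n.choose l : R[T;T⁻¹]) *
        (LaurentPolynomial.C y ^ m * T 1 ^ (n - m) * (n.choose m : R[T;T⁻¹]))).coeff j =
      if (m : ℤ) = n - j - l then (n.choose l : R) * n.choose m * x ^ l * y ^ m else 0 := by
    intro m hm
    have hm' : m ≤ n := by simpa [Nat.lt_succ_iff] using hm
    have : (LaurentPolynomial.C x * T (-1)) ^ l * 1 ^ (n - l) * (n.choose l : R[T;T⁻¹]) *
        (LaurentPolynomial.C y ^ m * T 1 ^ (n - m) * (n.choose m : R[T;T⁻¹])) =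
        LaurentPolynomial.C ((n.choose l : R) * n.choose m * x ^ l * y ^ m) *
          T ((n : ℤ) - m - l) := by
      have hT : (T ((n : ℤ) - m - l) : R[T;T⁻¹]) = T (-1) ^ l * T 1 ^ (n - m) := by
        rw [T_pow, T_pow, ← T_add]
        congr 1
        push_cast [hm']
        ring
      rw [hT]
      simp only [map_mul, map_pow, map_natCast, mul_pow, one_pow]
      ring
    rw [this, coeff_C_mul_T]
    exact if_congr (by lia) rfl rfl
  rw [Finset.sum_congr rfl hterm]
  split_ifs with hle
  · obtain ⟨m, hm⟩ := Int.eq_ofNat_of_zero_le (show 0 ≤ (n : ℤ) - j - l by lia)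
    rw [hm, Int.toNat_natCast]
    simp only [Nat.cast_inj, Finset.sum_ite_eq', Finset.mem_range]
    split_ifs with hmn
    · rfl
    · rw [Nat.choose_eq_zero_of_lt (by lia : n < m)]
      simp
  · refine Finset.sum_eq_zero fun m _ => if_neg (by lia)

theorem pathFunctional_X_pow (x y : R) (k n : ℕ) :
    pathFunctional x y k (X ^ n) = pgfPlus x y n k := by
  have h : T (-1) * ((T 1 - downStep x y) * stepGF x y ^ n) =
      stepGF x y ^ n - LaurentPolynomial.C (x * y) * (stepGF x y ^ n * T (-2)) := by
    have hT : (T (-1) * T 1 : R[T;T⁻¹]) = 1 := by rw [← T_add]; simp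
    have hT2 : (T (-2) : R[T;T⁻¹]) = T (-1) * T (-1) := by rw [← T_add]; simp
    rw [downStep, hT2]
    linear_combination stepGF x y ^ n * hT
  have hs : (stepGF x y ^ n * T (-2)).coeff (k : ℤ) = (stepGF x y ^ n).coeff ((k : ℤ) + 2) := by
    rw [T]
    simpa using AddMonoidAlgebra.coeff_mul_single_apply (stepGF x y ^ n) 1 (-2) (k : ℤ)
  rw [pathFunctional_apply, eval₂_pow, eval₂_X, h, AddMonoidAlgebra.coeff_sub, Finsupp.sub_apply,
    ← LaurentPolynomial.smul_eq_C_mul, AddMonoidAlgebra.coeff_smul, Finsupp.smul_apply,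
    hs, smul_eq_mul, coeff_stepGF_pow, coeff_stepGF_pow, pgfPlus]

/-- The monic orthogonal polynomials of the moment functional of weighted Motzkin paths. -/
noncomputable def pathPoly (x y : R) (n : ℕ) : R[X] :=
  (dickson 2 (x * y) n).comp (X - Polynomial.C (x + y))

/-- The polynomial that takes the value `z ^ K + (xy/z) ^ K` at the step generating function. -/
noncomputable def powerSumPoly (x y : R) (K : ℕ) : R[X] :=
  (dickson 1 (x * y) K).comp (X - Polynomial.C (x + y))

/-- The polynomials `pathPoly` in the variable `z ^ K` instead of `z`. -/
noncomputable def dilatedPoly (x y : R) (K m : ℕ) : R[X] :=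
  (dickson 2 ((x * y) ^ K) m).comp (powerSumPoly x y K)

theorem X_sub_eval₂_stepGF (x y : R) :
    (X - Polynomial.C (x + y)).eval₂ LaurentPolynomial.C (stepGF x y) = T 1 + downStep x y := by
  rw [eval₂_sub, eval₂_X, Polynomial.eval₂_C, stepGF]
  ring

theorem sub_mul_eval₂_pathPoly (x y : R) (n : ℕ) :
    (T 1 - downStep x y) * (pathPoly x y n).eval₂ LaurentPolynomial.C (stepGF x y) =
      T 1 ^ (n + 1) - downStep x y ^ (n + 1) := by
  rw [pathPoly, eval₂_comp, X_sub_eval₂_stepGF,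
    dickson_two_eval₂ _ _ _ _ (C_mul_downStep x y), mul_comm,
    ← (Commute.all (T 1) (downStep x y)).geom_sum₂_mul]
  simp

theorem eval₂_dilatedPoly (x y : R) (K m : ℕ) :
    (dilatedPoly x y K m).eval₂ LaurentPolynomial.C (stepGF x y) =
      ∑ s ∈ Finset.range (m + 1), (T 1 ^ K) ^ s * (downStep x y ^ K) ^ (m - s) := by
  rw [dilatedPoly, eval₂_comp, powerSumPoly, eval₂_comp, X_sub_eval₂_stepGF,
    dickson_one_eval₂ _ _ _ _ (C_mul_downStep x y),
    dickson_two_eval₂ _ _ _ _ (by rw [map_pow, C_mul_downStep, mul_pow])]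

theorem dilatedPoly_eval_zero (x y : R) (K m : ℕ) :
    (dilatedPoly x y K m).eval 0 =
      (-1) ^ (K * m) * ∑ s ∈ Finset.range (m + 1), x ^ (s * K) * y ^ ((m - s) * K) := by
  have hx : (X - Polynomial.C (x + y)).eval 0 = -x + -y := by simp; ring
  rw [dilatedPoly, eval_comp, powerSumPoly, eval_comp, hx, ← eval₂_id, ← eval₂_id,
    dickson_one_eval₂ _ _ _ _ (by simp),
    dickson_two_eval₂ _ _ _ _ (by rw [RingHom.id_apply, ← mul_pow, neg_mul_neg]), Finset.mul_sum]
  refine Finset.sum_congr rfl fun s hs => ?_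
  obtain ⟨d, rfl⟩ := Nat.exists_eq_add_of_le (show s ≤ m by simpa [Nat.lt_succ_iff] using hs)
  rw [neg_pow x, neg_pow y, Nat.add_sub_cancel_left, mul_pow, mul_pow]
  ring

theorem pathFunctional_pathPoly_mul_dilatedPoly (x y : R) (k c b : ℕ) (hc : c ≤ 2 * k) :
    pathFunctional x y k (pathPoly x y c * dilatedPoly x y (k + 1) b) =
      if c = k ∧ b = 0 then 1 else 0 := by
  rw [pathFunctional_apply, eval₂_mul, ← mul_assoc (T 1 - _), sub_mul_eval₂_pathPoly,
    eval₂_dilatedPoly]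
  by_cases hck : c = k
  · subst hck
    have h := (Commute.all ((T 1 : R[T;T⁻¹]) ^ (c + 1)) (downStep x y ^ (c + 1))).geom_sum₂_mul
      (b + 1)
    simp only [Nat.add_sub_cancel] at h
    have hz := coeff_pow_mul_downStep_pow x y c ((c + 1) * (b + 1)) 0
    have hw := coeff_pow_mul_downStep_pow x y c 0 ((c + 1) * (b + 1))
    rw [pow_zero, mul_one, zero_add] at hz
    rw [pow_zero, one_mul, if_neg (by lia)] at hw
    rw [mul_comm (_ - _), h, ← pow_mul, ← pow_mul, mul_sub, AddMonoidAlgebra.coeff_sub,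
      Finsupp.sub_apply, hz, hw]
    simp
  · rw [if_neg (by tauto), Finset.mul_sum, Finset.mul_sum, AddMonoidAlgebra.coeff_sum,
      Finsupp.finsetSum_apply]
    refine Finset.sum_eq_zero fun s _ => ?_
    have hdvd : ¬ (k + 1) ∣ (c + 1) := by
      rintro ⟨d, hd⟩
      rcases d with _ | _ | d
      · lia
      · lia
      · nlinarith
    have : T (-1) * ((T 1 ^ (c + 1) - downStep x y ^ (c + 1)) *
        ((T 1 ^ (k + 1)) ^ s * (downStep x y ^ (k + 1)) ^ (b - s))) =
        T (-1) * (T 1 ^ (c + 1 + (k + 1) * s) * downStep x y ^ ((k + 1) * (b - s))) -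
        T (-1) * (T 1 ^ ((k + 1) * s) * downStep x y ^ (c + 1 + (k + 1) * (b - s))) := by
      ring
    rw [this, AddMonoidAlgebra.coeff_sub, Finsupp.sub_apply, coeff_pow_mul_downStep_pow,
      coeff_pow_mul_downStep_pow, if_neg, if_neg, sub_zero]
    · intro h
      refine hdvd ((Nat.dvd_add_right (Dvd.intro ((b - s) + 1) rfl)).1
        (Dvd.intro s (h.trans ?_)))
      ring
    · intro h
      refine hdvd ((Nat.dvd_add_left (Dvd.intro s rfl)).1
        (Dvd.intro ((b - s) + 1) (Eq.trans ?_ h.symm)))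
      ring

theorem X_mul_pathPoly_zero (x y : R) :
    X * pathPoly x y 0 = pathPoly x y 1 + Polynomial.C (x + y) * pathPoly x y 0 := by
  simp only [pathPoly, dickson_two_at_zero, dickson_one, one_comp, X_comp]
  ring

theorem X_mul_pathPoly_succ (x y : R) (n : ℕ) :
    X * pathPoly x y (n + 1) = pathPoly x y (n + 2) + Polynomial.C (x + y) * pathPoly x y (n + 1) +
      Polynomial.C (x * y) * pathPoly x y n := by
  simp only [pathPoly, dickson_add_two, sub_comp, mul_comp, X_comp, C_comp]
  ring

theorem pathFunctional_C_mul (x y : R) (k : ℕ) (r : R) (f : R[X]) :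
    pathFunctional x y k (Polynomial.C r * f) = r * pathFunctional x y k f := by
  rw [← Polynomial.smul_eq_C_mul, map_smul, smul_eq_mul]

theorem pathFunctional_X_pow_mul_pathPoly_mul (x y : R) (k a c b : ℕ) :
    (0 < b → a + c ≤ 2 * k →
      pathFunctional x y k (X ^ a * pathPoly x y c * dilatedPoly x y (k + 1) b) = 0) ∧
    (a + c < k → pathFunctional x y k (X ^ a * pathPoly x y c * dilatedPoly x y (k + 1) 0) = 0) ∧
    (a + c = k →
      pathFunctional x y k (X ^ a * pathPoly x y c * dilatedPoly x y (k + 1) 0) = 1) := by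
  induction a generalizing c with
  | zero =>
    simp only [pow_zero, one_mul, zero_add]
    refine ⟨fun hb hc => ?_, fun hc => ?_, fun hc => ?_⟩
    · rw [pathFunctional_pathPoly_mul_dilatedPoly x y k c b hc, if_neg (by lia)]
    · rw [pathFunctional_pathPoly_mul_dilatedPoly x y k c 0 (by lia), if_neg (by lia)]
    · rw [pathFunctional_pathPoly_mul_dilatedPoly x y k c 0 (by lia), if_pos (by lia)]
  | succ a ih =>
    cases c with
    | zero =>
      have h : ∀ d, pathFunctional x y k (X ^ (a + 1) * pathPoly x y 0 * d) =
          pathFunctional x y k (X ^ a * pathPoly x y 1 * d) +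
            (x + y) * pathFunctional x y k (X ^ a * pathPoly x y 0 * d) := by
        intro d
        rw [← pathFunctional_C_mul, ← map_add]
        congr 1
        linear_combination X ^ a * d * X_mul_pathPoly_zero x y
      simp only [h]
      refine ⟨fun hb hc => ?_, fun hc => ?_, fun hc => ?_⟩
      · rw [(ih 1).1 hb (by lia), (ih 0).1 hb (by lia)]; ring
      · rw [(ih 1).2.1 (by lia), (ih 0).2.1 (by lia)]; ring
      · rw [(ih 1).2.2 (by lia), (ih 0).2.1 (by lia)]; ring
    | succ c =>
      have h : ∀ d, pathFunctional x y k (X ^ (a + 1) * pathPoly x y (c + 1) * d) =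
          pathFunctional x y k (X ^ a * pathPoly x y (c + 2) * d) +
            (x + y) * pathFunctional x y k (X ^ a * pathPoly x y (c + 1) * d) +
            x * y * pathFunctional x y k (X ^ a * pathPoly x y c * d) := by
        intro d
        rw [← pathFunctional_C_mul, ← pathFunctional_C_mul, ← map_add, ← map_add]
        congr 1
        linear_combination X ^ a * d * X_mul_pathPoly_succ x y c
      simp only [h]
      refine ⟨fun hb hc => ?_, fun hc => ?_, fun hc => ?_⟩
      · rw [(ih (c + 2)).1 hb (by lia), (ih (c + 1)).1 hb (by lia), (ih c).1 hb (by lia)]; ring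
      · rw [(ih (c + 2)).2.1 (by lia), (ih (c + 1)).2.1 (by lia), (ih c).2.1 (by lia)]; ring
      · rw [(ih (c + 2)).2.2 (by lia), (ih (c + 1)).2.1 (by lia), (ih c).2.1 (by lia)]; ring

theorem dilatedPoly_zero (x y : R) (K : ℕ) : dilatedPoly x y K 0 = 1 := by
  rw [dilatedPoly, dickson_two_at_zero, one_comp]

theorem pathPoly_zero (x y : R) : pathPoly x y 0 = 1 := by
  rw [pathPoly, dickson_two_at_zero, one_comp]

theorem pathFunctional_X_pow_of_lt (x y : R) {k a : ℕ} (h : a < k) :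
    pathFunctional x y k (X ^ a) = 0 := by
  simpa [pathPoly_zero, dilatedPoly_zero] using
    (pathFunctional_X_pow_mul_pathPoly_mul x y k a 0 0).2.1 h

theorem pathFunctional_X_pow_self (x y : R) (k : ℕ) :
    pathFunctional x y k (X ^ k) = 1 := by
  simpa [pathPoly_zero, dilatedPoly_zero] using
    (pathFunctional_X_pow_mul_pathPoly_mul x y k k 0 0).2.2 rfl

theorem pathFunctional_X_pow_mul_dilatedPoly (x y : R) {k a b : ℕ} (ha : a ≤ 2 * k) (hb : 0 < b) :
    pathFunctional x y k (X ^ a * dilatedPoly x y (k + 1) b) = 0 := by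
  simpa [pathPoly_zero] using (pathFunctional_X_pow_mul_pathPoly_mul x y k a 0 b).1 hb ha

theorem dilatedPoly_mul (x y : R) (K m l : ℕ) :
    dilatedPoly x y K (m + 1) * dilatedPoly x y K (l + 1) = dilatedPoly x y K (m + l + 2) +
      Polynomial.C ((x * y) ^ K) * (dilatedPoly x y K m * dilatedPoly x y K l) := by
  simp only [dilatedPoly]
  rw [← mul_comp, dickson_two_mul, add_comp, mul_comp, mul_comp, C_comp]

/-- Orthogonality of the polynomials `dilatedPoly`. -/
theorem pathFunctional_X_pow_mul_dilatedPoly_mul (x y : R) {k a : ℕ} (ha : a ≤ 2 * k) (m l : ℕ) :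
    pathFunctional x y k (X ^ a * (dilatedPoly x y (k + 1) m * dilatedPoly x y (k + 1) l)) =
      if m = l then ((x * y) ^ (k + 1)) ^ m * pathFunctional x y k (X ^ a) else 0 := by
  induction m generalizing l with
  | zero =>
    cases l with
    | zero => simp [dilatedPoly_zero]
    | succ l =>
      simp [dilatedPoly_zero, pathFunctional_X_pow_mul_dilatedPoly x y ha (Nat.succ_pos l)]
  | succ m ih =>
    cases l with
    | zero => simp [dilatedPoly_zero, pathFunctional_X_pow_mul_dilatedPoly x y ha (Nat.succ_pos m)]
    | succ l =>
      rw [dilatedPoly_mul, mul_add, map_add,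
        pathFunctional_X_pow_mul_dilatedPoly x y ha (Nat.succ_pos _), mul_left_comm,
        pathFunctional_C_mul, ih]
      by_cases h : m = l
      · simp [h]; ring
      · simp [h]

end PathFunctional

section Evaluation

open Polynomial

variable {R : Type*} [CommRing R]

theorem mul_add_div_mod {i K : ℕ} (l : ℕ) (hi : i < K) :
    (l * K + i) / K = l ∧ (l * K + i) % K = i :=
  ⟨by rw [mul_comm, Nat.mul_add_div (by lia), Nat.div_eq_of_lt hi, add_zero],
    by rw [mul_comm, Nat.mul_add_mod, Nat.mod_eq_of_lt hi]⟩

/-- A basis of monic polynomials that makes the Hankel matrix block diagonal. -/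
noncomputable def blockBasis (x y : R) (k a : ℕ) : R[X] :=
  X ^ (a % (k + 1)) * dilatedPoly x y (k + 1) (a / (k + 1))

theorem powerSumPoly_monic_natDegree [Nontrivial R] (x y : R) (k : ℕ) :
    (powerSumPoly x y (k + 1)).Monic ∧ (powerSumPoly x y (k + 1)).natDegree = k + 1 := by
  obtain ⟨hm, hd, -⟩ := dickson_monic_natDegree 1 (x * y) k
  have hX := monic_X_sub_C (x + y)
  refine ⟨hm.comp hX (by rw [natDegree_X_sub_C]; exact one_ne_zero), ?_⟩
  rw [powerSumPoly, natDegree_comp_eq_of_mul_ne_zero, hd, natDegree_X_sub_C, mul_one]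
  rw [hm.leadingCoeff, hX.leadingCoeff]
  simp

theorem dilatedPoly_monic_natDegree [Nontrivial R] (x y : R) (k m : ℕ) :
    (dilatedPoly x y (k + 1) m).Monic ∧
      (dilatedPoly x y (k + 1) m).natDegree = m * (k + 1) := by
  cases m with
  | zero => simp [dilatedPoly_zero]
  | succ m =>
    obtain ⟨hm, hd, -⟩ := dickson_monic_natDegree 2 ((x * y) ^ (k + 1)) m
    obtain ⟨hm', hd'⟩ := powerSumPoly_monic_natDegree x y k
    refine ⟨hm.comp hm' (by rw [hd']; exact Nat.succ_ne_zero k), ?_⟩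
    rw [dilatedPoly, natDegree_comp_eq_of_mul_ne_zero, hd, hd']
    rw [hm.leadingCoeff, hm'.leadingCoeff]
    simp

theorem blockBasis_monic [Nontrivial R] (x y : R) (k a : ℕ) : (blockBasis x y k a).Monic :=
  (monic_X_pow _).mul (dilatedPoly_monic_natDegree x y k _).1

theorem blockBasis_natDegree [Nontrivial R] (x y : R) (k a : ℕ) :
    (blockBasis x y k a).natDegree = a := by
  rw [blockBasis, (monic_X_pow _).natDegree_mul (dilatedPoly_monic_natDegree x y k _).1,
    (dilatedPoly_monic_natDegree x y k _).2, natDegree_X_pow, Nat.mod_add_div']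

theorem pathFunctional_blockBasis_mul (x y : R) (k i j : ℕ) :
    pathFunctional x y k (blockBasis x y k i * blockBasis x y k j) =
      if i / (k + 1) = j / (k + 1) then ((x * y) ^ (k + 1)) ^ (i / (k + 1)) *
        pathFunctional x y k (X ^ (i % (k + 1) + j % (k + 1))) else 0 := by
  have hi := Nat.mod_lt i (Nat.succ_pos k)
  have hj := Nat.mod_lt j (Nat.succ_pos k)
  rw [← pathFunctional_X_pow_mul_dilatedPoly_mul x y (by lia), blockBasis, blockBasis, pow_add]
  congr 1
  ring

/-- The matrix obtained from the Hankel matrix of `pathFunctional` in the basis `blockBasis` by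
replacing row `n` by the values of the basis at `0`. -/
noncomputable def borderedGram (x y : R) (k n i j : ℕ) : R :=
  if i < n then pathFunctional x y k (blockBasis x y k i * blockBasis x y k j)
  else (blockBasis x y k j).eval 0

theorem det_pgfPlus_eq_borderedGram [Nontrivial R] (x y : R) (k n : ℕ) :
    (Matrix.of fun i j : Fin n => pgfPlus x y (i.1 + j.1 + 1) (k : ℤ)).det =
      (-1) ^ n * (Matrix.of fun i j : Fin (n + 1) => borderedGram x y k n i j).det := by
  have hcols := det_linearMap_monic
    (fun j : Fin n => (pathFunctional x y k).comp (LinearMap.mulLeft R (X ^ (j.1 + 1))))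
    (blockBasis x y k) (blockBasis_natDegree x y k) (blockBasis_monic x y k)
  have hborder := det_of_last_row_eq_single (n := n)
    (fun i j => if i < n then pathFunctional x y k (blockBasis x y k i * X ^ j)
      else eval 0 (X ^ j)) (fun j hj _ => by simp [hj.ne'])
  have hrows := det_linearMap_monic
    (fun i : Fin (n + 1) => if i.1 < n then
      (pathFunctional x y k).comp (LinearMap.mulLeft R (blockBasis x y k i)) else leval 0)
    (blockBasis x y k) (blockBasis_natDegree x y k) (blockBasis_monic x y k)
  have h1 : (Matrix.of fun i j : Fin n => pgfPlus x y (i.1 + j.1 + 1) (k : ℤ)) =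
      Matrix.of fun j i : Fin n => ((pathFunctional x y k).comp
        (LinearMap.mulLeft R (X ^ (j.1 + 1)))) (X ^ (i : ℕ)) := by
    ext i j
    simp only [Matrix.of_apply, LinearMap.comp_apply, LinearMap.mulLeft_apply]
    rw [← pow_add, pathFunctional_X_pow]
    congr 1
    ring
  have h2 : (Matrix.of fun j i : Fin n => ((pathFunctional x y k).comp
        (LinearMap.mulLeft R (X ^ (j.1 + 1)))) (blockBasis x y k i)).transpose =
      Matrix.of fun i j : Fin n => if i.1 < n then
        pathFunctional x y k (blockBasis x y k i * X ^ (j.1 + 1)) else eval 0 (X ^ (j.1 + 1)) := by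
    ext i j
    simp [mul_comm]
  have h3 : (Matrix.of fun i j : Fin (n + 1) => (if i.1 < n then
      (pathFunctional x y k).comp (LinearMap.mulLeft R (blockBasis x y k i)) else leval 0)
        (X ^ (j : ℕ))) =
      Matrix.of fun i j : Fin (n + 1) => if i.1 < n then
        pathFunctional x y k (blockBasis x y k i * X ^ (j : ℕ)) else eval 0 (X ^ (j : ℕ)) := by
    ext i j
    simp only [Matrix.of_apply]
    split_ifs <;> rfl
  have h4 : (Matrix.of fun i j : Fin (n + 1) => (if i.1 < n then
      (pathFunctional x y k).comp (LinearMap.mulLeft R (blockBasis x y k i)) else leval 0)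
        (blockBasis x y k j)) =
      Matrix.of fun i j : Fin (n + 1) => borderedGram x y k n i j := by
    ext i j
    simp only [Matrix.of_apply, borderedGram]
    split_ifs <;> rfl
  rw [h3, h4] at hrows
  rw [h1, ← hcols, ← Matrix.det_transpose, h2, hrows, hborder]
  simp [← mul_assoc, ← mul_pow]

theorem det_pgfPlus_eq_last_block [Nontrivial R] (x y : R) (k n m r : ℕ)
    (hn : n = m * (k + 1) + r) :
    (Matrix.of fun i j : Fin n => pgfPlus x y (i.1 + j.1 + 1) (k : ℤ)).det =
      (-1) ^ (n + m * (k + 1).choose 2) * (x * y) ^ ((k + 1) ^ 2 * m.choose 2) *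
        (Matrix.of fun i j : Fin (r + 1) =>
          borderedGram x y k n (m * (k + 1) + i) (m * (k + 1) + j)).det := by
  have hdiag : (Matrix.of fun i j : Fin (m * (k + 1)) => borderedGram x y k n i j).det =
      (-1) ^ (m * (k + 1).choose 2) * (x * y) ^ ((k + 1) ^ 2 * m.choose 2) := by
    have h1 : (Matrix.of fun i j : Fin (m * (k + 1)) => borderedGram x y k n i j) =
        Matrix.of fun i j : Fin (m * (k + 1)) =>
          pathFunctional x y k (blockBasis x y k i * blockBasis x y k j) := by
      ext i j
      exact if_pos (by lia)
    rw [h1, det_of_diagonal_blocks (k + 1) m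
      (fun i j => pathFunctional x y k (blockBasis x y k i * blockBasis x y k j))
      (fun i j hij => by rw [pathFunctional_blockBasis_mul, if_neg hij])]
    have hblock : ∀ l ∈ Finset.range m, (Matrix.of fun i j : Fin (k + 1) =>
        pathFunctional x y k (blockBasis x y k (l * (k + 1) + i) *
          blockBasis x y k (l * (k + 1) + j))).det =
        (-1) ^ (k + 1).choose 2 * ((x * y) ^ (k + 1) ^ 2) ^ l := by
      intro l _
      have hval : ∀ i j, i < k + 1 → j < k + 1 →
          pathFunctional x y k (blockBasis x y k (l * (k + 1) + i) *
            blockBasis x y k (l * (k + 1) + j)) =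
          ((x * y) ^ (k + 1)) ^ l * pathFunctional x y k (X ^ (i + j)) := by
        intro i j hi hj
        obtain ⟨hi1, hi2⟩ := mul_add_div_mod l hi
        obtain ⟨hj1, hj2⟩ := mul_add_div_mod l hj
        rw [pathFunctional_blockBasis_mul, hi1, hi2, hj1, hj2, if_pos rfl]
      rw [det_of_antitriangular (k + 1) (fun i j =>
          pathFunctional x y k (blockBasis x y k (l * (k + 1) + i) *
            blockBasis x y k (l * (k + 1) + j))) ?_ (((x * y) ^ (k + 1)) ^ l) ?_]
      · ring
      · intro i j hij
        rw [hval i j (by lia) (by lia), pathFunctional_X_pow_of_lt x y (by lia), mul_zero]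
      · intro i j hij
        rw [hval i j (by lia) (by lia), show i + j = k by lia, pathFunctional_X_pow_self, mul_one]
    rw [Finset.prod_congr rfl hblock, Finset.prod_mul_distrib, Finset.prod_const,
      Finset.card_range, Finset.prod_pow_eq_pow_sum, Finset.sum_range_id, Nat.choose_two_right m,
      ← pow_mul, ← pow_mul, mul_comm m ((k + 1).choose 2)]
  rw [det_pgfPlus_eq_borderedGram, det_of_lower_blocks (N := m * (k + 1)) (s := r + 1)
    (by lia) (borderedGram x y k n), hdiag]
  · ring
  · intro i j hi hj _
    have h1 : i / (k + 1) < m := Nat.div_lt_of_lt_mul (by rwa [mul_comm])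
    have h2 : m ≤ j / (k + 1) := (Nat.le_div_iff_mul_le (Nat.succ_pos k)).2 hj
    rw [borderedGram, if_pos (by lia), pathFunctional_blockBasis_mul, if_neg (by lia)]

theorem borderedGram_last_block (x y : R) (k n m r i j : ℕ) (hn : n = m * (k + 1) + r)
    (hr : r ≤ k) (hi : i ≤ r) (hj : j ≤ r) :
    borderedGram x y k n (m * (k + 1) + i) (m * (k + 1) + j) =
      if i < r then ((x * y) ^ (k + 1)) ^ m * pathFunctional x y k (X ^ (i + j))
      else 0 ^ j * (dilatedPoly x y (k + 1) m).eval 0 := by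
  obtain ⟨hi1, hi2⟩ := mul_add_div_mod (i := i) (K := k + 1) m (by lia)
  obtain ⟨hj1, hj2⟩ := mul_add_div_mod (i := j) (K := k + 1) m (by lia)
  rw [borderedGram, pathFunctional_blockBasis_mul, hi1, hi2, hj1, hj2, if_pos rfl, blockBasis,
    hj1, hj2, eval_mul, eval_pow, eval_X]
  exact if_congr (by lia) rfl rfl

/-- The last block in terms of its antitriangular part. -/
theorem det_borderedGram_last_block (x y : R) (k n m r : ℕ) (hn : n = m * (k + 1) + r)
    (hr : r = 0 ∨ r = k) :
    (Matrix.of fun i j : Fin (r + 1) =>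
      borderedGram x y k n (m * (k + 1) + i) (m * (k + 1) + j)).det =
      (-1) ^ (r + r.choose 2) * (x * y) ^ (m * r * (k + 1)) *
        (dilatedPoly x y (k + 1) m).eval 0 := by
  have hrk : r ≤ k := by lia
  have hval := borderedGram_last_block x y k n m r (hn := hn) (hr := hrk)
  have hc := det_of_antitriangular r
    (fun i j => borderedGram x y k n (m * (k + 1) + i) (m * (k + 1) + (j + 1)))
    (fun i j hij => by
      rw [hval i (j + 1) (by lia) (by lia), if_pos (by lia),
        pathFunctional_X_pow_of_lt x y (by lia), mul_zero])
    (((x * y) ^ (k + 1)) ^ m) (fun i j hij => by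
      rw [hval i (j + 1) (by lia) (by lia), if_pos (by lia), show i + (j + 1) = k by lia,
        pathFunctional_X_pow_self, mul_one])
  rw [det_of_last_row_eq_single
    (fun i j => borderedGram x y k n (m * (k + 1) + i) (m * (k + 1) + j)), hc,
    hval r 0 le_rfl (Nat.zero_le r)]
  · rw [if_neg (lt_irrefl r)]
    ring
  · intro j hj hjr
    rw [hval r j le_rfl hjr, if_neg (lt_irrefl r), zero_pow hj.ne', zero_mul]

end Evaluation

/-- Theorem 2: evaluation of `det_{0≤i,j≤n−1}(P⁺_{i+j+1}(0,k))`.  The sum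
`Σ_{s=0}^{n₁} x^{s(k+1)} y^{(n₁−s)(k+1)}` is the polynomial form of
`(y^{(k+1)(n₁+1)}−x^{(k+1)(n₁+1)})/(y^{k+1}−x^{k+1})`. -/
theorem det_hankel_pgfPlus_one {R : Type*} [CommRing R] (x y : R) (n : ℕ) (hn : 0 < n)
    (k : ℕ) :
    (∀ n₁ : ℕ, 0 < n₁ → n = n₁ * (k + 1) →
      Matrix.det (Matrix.of fun i j : Fin n => pgfPlus x y (i.1 + j.1 + 1) (k : ℤ)) =
        (-1 : R) ^ (n₁ * Nat.choose (k + 1) 2) *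
          (x * y) ^ ((k + 1) ^ 2 * Nat.choose n₁ 2) *
          ∑ s ∈ Finset.range (n₁ + 1), x ^ (s * (k + 1)) * y ^ ((n₁ - s) * (k + 1))) ∧
    (∀ n₁ : ℕ, n = n₁ * (k + 1) + k →
      Matrix.det (Matrix.of fun i j : Fin n => pgfPlus x y (i.1 + j.1 + 1) (k : ℤ)) =
        (-1 : R) ^ (n₁ * Nat.choose (k + 1) 2 + Nat.choose k 2) *
          (x * y) ^ ((k + 1) ^ 2 * Nat.choose n₁ 2 + n₁ * k * (k + 1)) *
          ∑ s ∈ Finset.range (n₁ + 1), x ^ (s * (k + 1)) * y ^ ((n₁ - s) * (k + 1))) ∧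
    (n % (k + 1) ≠ 0 ∧ n % (k + 1) ≠ k →
      Matrix.det (Matrix.of fun i j : Fin n => pgfPlus x y (i.1 + j.1 + 1) (k : ℤ)) = 0) := by
  nontriviality R
  refine ⟨fun m _ hm => ?_, fun m hm => ?_, fun ⟨h0, hk⟩ => ?_⟩
  · rw [det_pgfPlus_eq_last_block x y k n m 0 hm,
      det_borderedGram_last_block x y k n m 0 hm (Or.inl rfl), dilatedPoly_eval_zero, hm,
      mul_comm m (k + 1)]
    have hsq : ((-1 : R) ^ ((k + 1) * m)) * (-1) ^ ((k + 1) * m) = 1 := by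
      rw [← mul_pow]; simp
    rw [pow_add, Nat.choose_zero_succ, mul_zero, zero_mul, pow_zero, pow_zero]
    linear_combination ((-1 : R) ^ (m * (k + 1).choose 2) *
      (x * y) ^ ((k + 1) ^ 2 * m.choose 2) *
      ∑ s ∈ Finset.range (m + 1), x ^ (s * (k + 1)) * y ^ ((m - s) * (k + 1))) * hsq
  · rw [det_pgfPlus_eq_last_block x y k n m k hm,
      det_borderedGram_last_block x y k n m k hm (Or.inr rfl), dilatedPoly_eval_zero, hm,
      mul_comm m (k + 1)]
    have hsq : ((-1 : R) ^ ((k + 1) * m + k)) * (-1) ^ ((k + 1) * m + k) = 1 := by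
      rw [← mul_pow]; simp
    linear_combination ((-1 : R) ^ (m * (k + 1).choose 2 + k.choose 2) *
      (x * y) ^ ((k + 1) ^ 2 * m.choose 2 + m * k * (k + 1)) *
      ∑ s ∈ Finset.range (m + 1), x ^ (s * (k + 1)) * y ^ ((m - s) * (k + 1))) * hsq
  · have hlt := Nat.mod_lt n (Nat.succ_pos k)
    have hn' : n = n / (k + 1) * (k + 1) + n % (k + 1) := (Nat.div_add_mod' n (k + 1)).symm
    rw [det_pgfPlus_eq_last_block x y k n _ _ hn',
      Matrix.det_eq_zero_of_row_eq_zero 0, mul_zero]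
    intro j
    rw [Matrix.of_apply, Fin.val_zero,
      borderedGram_last_block x y k n _ _ 0 j hn' (by lia) (Nat.zero_le _)
        (Nat.le_of_lt_succ j.2), if_pos (Nat.pos_of_ne_zero h0),
      pathFunctional_X_pow_of_lt x y (by lia), mul_zero]
end
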